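/- arXiv:1709.02959 — 7 statements merged into one kernel-verified Lean document; each statement's English description precedes it below -/
import Mathlib

section
/- Let n = 2^m with m ≥ 1, and let f : F_2^n → F_2 satisfy f(ρ(x)) = f(x) ⊕ 1 for every x ∈ F_2^n with x ≠ 0 and x ≠ 1. Then f is weightwise perfectly balanced: for every integer k with 1 ≤ k ≤ n−1, 2·|{x ∈ F_2^n : w_H(x) = k and f(x) = 1}| = binom(n,k). -/
/-- Left cyclic shift on `F_2^n`: `(rho x) i = x ((i+1) mod n)`. -/
def rho {n : ℕ} (x : Fin n → ZMod 2) : Fin n → ZMod 2 :=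
  fun i => x ⟨(i.val + 1) % n, Nat.mod_lt _ i.pos⟩

theorem aux_z2 (a : ZMod 2) (h : a ≠ 0) : a = 1 := by
  revert a; decide

theorem aux_count (n k : ℕ) :
    (Finset.univ.filter (fun x : Fin n → ZMod 2 => hammingNorm x = k)).card = n.choose k := by
  have h : (Finset.powersetCard k (Finset.univ : Finset (Fin n))).card = n.choose k := by
    simp
  rw [← h]
  refine Finset.card_bij' (fun x _ => Finset.univ.filter (fun i => x i ≠ 0))
    (fun s _ => fun i => if i ∈ s then 1 else 0) ?_ ?_ ?_ ?_
  · intro x hx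
    simp only [Finset.mem_filter, Finset.mem_univ, true_and] at hx
    rw [Finset.mem_powersetCard]
    exact ⟨Finset.subset_univ _, hx⟩
  · intro s hs
    rw [Finset.mem_powersetCard] at hs
    simp only [Finset.mem_filter, Finset.mem_univ, true_and, hammingNorm]
    rw [← hs.2]
    congr 1
    ext i
    simp
  · intro x hx
    funext i
    by_cases hi : x i = 0
    · simp [hi]
    · simp [aux_z2 _ hi]
  · intro s hs
    ext i
    simp

theorem stmt_0 (m : ℕ) (hm : 1 ≤ m) (n : ℕ) (hn : n = 2 ^ m)
    (f : (Fin n → ZMod 2) → ZMod 2)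
    (hf : ∀ x : Fin n → ZMod 2, x ≠ 0 → x ≠ 1 → f (rho x) = f x + 1) :
    ∀ k : ℕ, 1 ≤ k → k ≤ n - 1 →
      2 * (Finset.univ.filter
            (fun x : Fin n → ZMod 2 => hammingNorm x = k ∧ f x = 1)).card
        = n.choose k := by
  intro k hk1 hk2
  have hinj : Function.Injective
      (fun i : Fin n => (⟨(i.val + 1) % n, Nat.mod_lt _ i.pos⟩ : Fin n)) := by
    intro i j hij
    have h1 : (i.val + 1) % n = (j.val + 1) % n := congrArg Fin.val hij
    have h2 : i.val ≡ j.val [MOD n] := Nat.ModEq.add_right_cancel' 1 h1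
    exact Fin.ext (Nat.ModEq.eq_of_lt_of_lt h2 i.isLt j.isLt)
  let e : Fin n ≃ Fin n := Equiv.ofBijective _ (Finite.injective_iff_bijective.mp hinj)
  have hrho : ∀ x : Fin n → ZMod 2, rho x = x ∘ e := fun x => rfl
  have hnorm : ∀ x : Fin n → ZMod 2, hammingNorm (x ∘ e) = hammingNorm x := by
    intro x
    unfold hammingNorm
    refine Finset.card_equiv e ?_
    intro i
    simp
  have hflip : ∀ x : Fin n → ZMod 2, hammingNorm x = k → f (x ∘ e) = f x + 1 := by
    intro x hx
    rw [← hrho]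
    apply hf
    · rintro rfl
      simp at hx
      omega
    · rintro rfl
      simp [hammingNorm] at hx
      omega
  have hcard : (Finset.univ.filter
      (fun x : Fin n → ZMod 2 => hammingNorm x = k ∧ f x = 1)).card =
      (Finset.univ.filter
      (fun x : Fin n → ZMod 2 => hammingNorm x = k ∧ ¬ f x = 1)).card := by
    refine Finset.card_equiv (Equiv.arrowCongr e.symm (Equiv.refl _)) ?_
    intro x
    have hx' : (Equiv.arrowCongr e.symm (Equiv.refl (ZMod 2))) x = x ∘ e := rfl
    rw [hx']
    simp only [Finset.mem_filter, Finset.mem_univ, true_and, hnorm]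
    refine and_congr_right fun h => ?_
    rw [hflip x h]
    generalize f x = a
    revert a
    decide
  have hsplit := Finset.card_filter_add_card_filter_not
    (s := Finset.univ.filter (fun x : Fin n → ZMod 2 => hammingNorm x = k)) (fun x => f x = 1)
  rw [Finset.filter_filter, Finset.filter_filter, aux_count] at hsplit
  omega
end

section
/- Let n = 2^m with m ≥ 1 and let f : F_2^n → F_2 satisfy f(ρ(x)) = f(x) ⊕ 1 for every x ∈ F_2^n with x ≠ 0 and x ≠ 1. Then for every x_0 ∈ F_2^n with x_0 ≠ 0 and x_0 ≠ 1, f is balanced on the cyclic-shift orbit O = {ρ^j(x_0) : 0 ≤ j ≤ n−1} of x_0, i.e., 2·|{z ∈ O : f(z) = 1}| = |O|. -/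
theorem rho_iter_aux {n : ℕ} (x : Fin n → ZMod 2) (j : ℕ) (i : Fin n) :
    (rho^[j] x) i = x ⟨(i.val + j) % n, Nat.mod_lt _ i.pos⟩ := by
  induction j generalizing i with
  | zero => simp [Nat.mod_eq_of_lt i.isLt]
  | succ j ih =>
    rw [Function.iterate_succ_apply']
    show (rho^[j] x) _ = _
    rw [ih]
    congr 1
    apply Fin.ext
    simp only [Nat.mod_add_mod]
    congr 1
    omega

theorem rho_period_aux {n : ℕ} (x : Fin n → ZMod 2) : rho^[n] x = x := by
  funext i
  rw [rho_iter_aux]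
  congr 1
  apply Fin.ext
  simp [Nat.mod_eq_of_lt i.isLt]

theorem rho_inj_aux {n : ℕ} : Function.Injective (rho (n := n)) := by
  intro x y h
  rcases n with _ | k
  · exact Subsingleton.elim _ _
  · rw [← rho_period_aux x, ← rho_period_aux y, Function.iterate_succ_apply,
      Function.iterate_succ_apply, h]

theorem stmt_2 (m : ℕ) (hm : 1 ≤ m) (n : ℕ) (hn : n = 2 ^ m)
    (f : (Fin n → ZMod 2) → ZMod 2)
    (hf : ∀ x : Fin n → ZMod 2, x ≠ 0 → x ≠ 1 → f (rho x) = f x + 1)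
    (x₀ : Fin n → ZMod 2) (hx0 : x₀ ≠ 0) (hx1 : x₀ ≠ 1) :
    2 * (((Finset.range n).image (fun j => rho^[j] x₀)).filter
          (fun z => f z = 1)).card
      = ((Finset.range n).image (fun j => rho^[j] x₀)).card := by
  have hn0 : 0 < n := by rw [hn]; positivity
  have hne : ∀ j, rho^[j] x₀ ≠ 0 ∧ rho^[j] x₀ ≠ 1 := by
    intro j
    induction j with
    | zero => exact ⟨hx0, hx1⟩
    | succ j ih =>
      rw [Function.iterate_succ_apply']
      exact ⟨fun h => ih.1 (rho_inj_aux (h.trans rfl)), fun h => ih.2 (rho_inj_aux (h.trans rfl))⟩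
  set O := (Finset.range n).image (fun j => rho^[j] x₀) with hO
  have hmem : ∀ z ∈ O, rho z ∈ O ∧ f (rho z) = f z + 1 := by
    intro z hz
    obtain ⟨j, hj, rfl⟩ := Finset.mem_image.1 hz
    refine ⟨?_, hf _ (hne j).1 (hne j).2⟩
    show rho (rho^[j] x₀) ∈ O
    rw [← Function.iterate_succ_apply' rho j x₀]
    have hj' := Finset.mem_range.1 hj
    by_cases h : j + 1 = n
    · rw [Nat.succ_eq_add_one, h, rho_period_aux]
      exact Finset.mem_image.2 ⟨0, Finset.mem_range.2 hn0, rfl⟩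
    · exact Finset.mem_image.2 ⟨j + 1, Finset.mem_range.2 (by omega), rfl⟩
  have key : ∀ a : ZMod 2, a + 1 = 1 ↔ ¬ a = 1 := by decide
  have h1 : (O.filter (fun z => f z = 1)).card ≤ (O.filter (fun z => ¬ f z = 1)).card := by
    refine Finset.card_le_card_of_injOn rho ?_ rho_inj_aux.injOn
    intro z hz
    obtain ⟨hz, h⟩ := Finset.mem_filter.1 hz
    refine Finset.mem_filter.2 ⟨(hmem z hz).1, ?_⟩
    rw [(hmem z hz).2, key]
    exact not_not.2 h
  have h2 : (O.filter (fun z => ¬ f z = 1)).card ≤ (O.filter (fun z => f z = 1)).card := by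
    refine Finset.card_le_card_of_injOn rho ?_ rho_inj_aux.injOn
    intro z hz
    obtain ⟨hz, h⟩ := Finset.mem_filter.1 hz
    refine Finset.mem_filter.2 ⟨(hmem z hz).1, ?_⟩
    rw [(hmem z hz).2, key]
    exact h
  have h3 := Finset.card_filter_add_card_filter_not (s := O) (fun z => f z = 1)
  omega
end

section
/- Let n = 2^m with m ≥ 1, and let F_n be the family of functions f : F_2^n → F_2 such that f(0) = 0, f(1) = 1, and f(ρ(x)) = f(x) ⊕ 1 for all x ∈ F_2^n \ {0, 1}. Then for every f ∈ F_n and every integer k with 1 ≤ k ≤ n/2, the function g defined by g(x) = f(x ⊕ 1) ⊕ 1 belongs to F_n and satisfies NL_{E_{n,n−k}}(g) = NL_{E_{n,k}}(f). Consequently, the minimum of NL_{E_{n,k}} over F_n equals the minimum of NL_{E_{n,n−k}} over F_n. -/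
/-- Inner product over `F_2`. -/
def dot {n : ℕ} (a x : Fin n → ZMod 2) : ZMod 2 := ∑ i, a i * x i

/-- The slice `E_{n,k}` of vectors of Hamming weight `k`. -/
def E (n k : ℕ) : Finset (Fin n → ZMod 2) :=
  Finset.univ.filter (fun x => hammingNorm x = k)

/-- Nonlinearity of `f` restricted to a finite set `S ⊆ F_2^n`:
the minimum over affine functions `x ↦ a·x ⊕ ε` of the number of disagreements on `S`. -/
noncomputable def NL {n : ℕ} (f : (Fin n → ZMod 2) → ZMod 2)
    (S : Finset (Fin n → ZMod 2)) : ℕ :=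
  sInf {m : ℕ | ∃ a : Fin n → ZMod 2, ∃ ε : ZMod 2,
    m = (S.filter (fun x => f x ≠ dot a x + ε)).card}

/-- The family `F_N` of functions `f` with `f(0)=0`, `f(1)=1` and
`f(ρ(x)) = f(x) ⊕ 1` for all `x ∉ {0,1}`. -/
def Fam (N : ℕ) (f : (Fin N → ZMod 2) → ZMod 2) : Prop :=
  f 0 = 0 ∧ f 1 = 1 ∧
    ∀ x : Fin N → ZMod 2, x ≠ 0 → x ≠ 1 → f (rho x) = f x + 1

theorem aux_two (a : ZMod 2) : a + 1 + 1 = a := by revert a; decide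

theorem aux_vec {n : ℕ} (x : Fin n → ZMod 2) : x + 1 + 1 = x := by
  funext i; exact aux_two (x i)

theorem aux_norm {n : ℕ} (x : Fin n → ZMod 2) :
    hammingNorm (x + 1) + hammingNorm x = n := by
  have h := Finset.card_filter_add_card_filter_not (s := (Finset.univ : Finset (Fin n)))
    (fun i => x i ≠ 0)
  rw [Finset.card_univ, Fintype.card_fin] at h
  have e : hammingNorm (x + 1) =
      (Finset.univ.filter (fun i : Fin n => ¬ (x i ≠ 0))).card := by
    unfold hammingNorm
    congr 1
    apply Finset.filter_congr
    intro i _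
    have : ∀ a : ZMod 2, a + 1 ≠ 0 ↔ ¬ (a ≠ 0) := by decide
    exact this (x i)
  rw [e]
  unfold hammingNorm
  omega

theorem aux_dot {n : ℕ} (a x : Fin n → ZMod 2) : dot a (x + 1) = dot a x + dot a 1 := by
  simp [dot, mul_add, Finset.sum_add_distrib]

theorem aux_card {n j : ℕ} (hj : j ≤ n) (f : (Fin n → ZMod 2) → ZMod 2)
    (a : Fin n → ZMod 2) (ε : ZMod 2) :
    ((E n (n - j)).filter (fun x => f (x + 1) + 1 ≠ dot a x + ε)).card =
    ((E n j).filter (fun x => f x ≠ dot a x + (dot a 1 + ε + 1))).card := by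
  have key : ∀ p q r e : ZMod 2, p + 1 ≠ q + e ↔ p ≠ q + r + (r + e + 1) := by decide
  refine Finset.card_bij' (fun x _ => x + 1) (fun x _ => x + 1) ?_ ?_ ?_ ?_
  · intro x hx
    simp only [E, Finset.mem_filter, Finset.mem_univ, true_and] at hx ⊢
    have := aux_norm x
    refine ⟨by omega, ?_⟩
    rw [aux_dot]
    exact (key _ _ _ _).1 hx.2
  · intro x hx
    simp only [E, Finset.mem_filter, Finset.mem_univ, true_and] at hx ⊢
    have := aux_norm x
    refine ⟨by omega, ?_⟩
    rw [key _ _ (dot a 1), ← aux_dot, aux_vec]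
    exact hx.2
  · intro x _; exact aux_vec x
  · intro x _; exact aux_vec x

theorem aux_NL {n j : ℕ} (hj : j ≤ n) (f : (Fin n → ZMod 2) → ZMod 2) :
    NL (fun x => f (x + 1) + 1) (E n (n - j)) = NL f (E n j) := by
  unfold NL
  congr 1
  ext v
  constructor
  · rintro ⟨a, ε, rfl⟩
    exact ⟨a, _, aux_card hj f a ε⟩
  · rintro ⟨a, ε, rfl⟩
    refine ⟨a, dot a 1 + ε + 1, ?_⟩
    rw [aux_card hj f a]
    have : ∀ d e : ZMod 2, d + (d + e + 1) + 1 = e := by decide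
    rw [this]

theorem aux_Fam {n : ℕ} (f : (Fin n → ZMod 2) → ZMod 2) (hf : Fam n f) :
    Fam n (fun x => f (x + 1) + 1) := by
  obtain ⟨h0, h1, h⟩ := hf
  have e : (1 : Fin n → ZMod 2) + 1 = 0 := by simpa using aux_vec (0 : Fin n → ZMod 2)
  refine ⟨?_, ?_, ?_⟩
  · simp only [zero_add, h1]; decide
  · simp only [e, h0]; decide
  · intro x hx0 hx1
    have hr : rho x + 1 = rho (x + 1) := rfl
    simp only [hr]
    rw [h (x + 1)]
    · intro hx
      apply hx1
      rw [← aux_vec x, hx, zero_add]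
    · intro hx
      apply hx0
      rw [← aux_vec x, hx, e]

theorem stmt_13 (m : ℕ) (hm : 1 ≤ m) (n : ℕ) (hn : n = 2 ^ m)
    (k : ℕ) (hk1 : 1 ≤ k) (hk2 : k ≤ n / 2) :
    (∀ f : (Fin n → ZMod 2) → ZMod 2, Fam n f →
      Fam n (fun x => f (x + 1) + 1) ∧
      NL (fun x => f (x + 1) + 1) (E n (n - k)) = NL f (E n k)) ∧
    sInf {v : ℕ | ∃ f : (Fin n → ZMod 2) → ZMod 2, Fam n f ∧ v = NL f (E n k)}
      = sInf {v : ℕ | ∃ f : (Fin n → ZMod 2) → ZMod 2,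
          Fam n f ∧ v = NL f (E n (n - k))} := by
  have hkn : k ≤ n := by omega
  refine ⟨fun f hf => ⟨aux_Fam f hf, aux_NL hkn f⟩, ?_⟩
  congr 1
  ext v
  constructor
  · rintro ⟨f, hf, rfl⟩
    exact ⟨_, aux_Fam f hf, (aux_NL hkn f).symm⟩
  · rintro ⟨f, hf, rfl⟩
    refine ⟨_, aux_Fam f hf, ?_⟩
    have := aux_NL (Nat.sub_le n k) f
    rw [Nat.sub_sub_self hkn] at this
    exact this.symm
end

section
/- Let n be an even positive integer, let f : F_2^n → F_2, and define g : F_2^{n/2} → F_2 by g(y) = f(y, y), where (y, y) denotes the concatenation of y with itself. Then for every integer k, NL_{E_{n,2k}}(f) ≥ NL_{E_{n/2,k}}(g). -/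
/-- Concatenation `(y, y)` of a vector with itself. -/
def dup {t : ℕ} (y : Fin t → ZMod 2) : Fin (2 * t) → ZMod 2 :=
  fun i => y ⟨i.val % t, Nat.mod_lt _ (by have := i.isLt; omega)⟩

theorem dup_fin {t : ℕ} (y : Fin t → ZMod 2) (b : Fin 2) (j : Fin t) :
    dup y (finProdFinEquiv (b, j)) = y j := by
  unfold dup
  congr 1
  ext
  simp [Nat.add_mul_mod_self_left, Nat.mod_eq_of_lt j.isLt]

theorem sum_two {t : ℕ} {M : Type*} [AddCommMonoid M] (F : Fin (2 * t) → M) :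
    ∑ i, F i = ∑ j, (F (finProdFinEquiv (0, j)) + F (finProdFinEquiv (1, j))) := by
  rw [← finProdFinEquiv.sum_comp F, Fintype.sum_prod_type]
  simp [Finset.sum_add_distrib]

theorem norm_dup {t : ℕ} (y : Fin t → ZMod 2) :
    hammingNorm (dup y) = 2 * hammingNorm y := by
  unfold hammingNorm
  rw [Finset.card_filter, Finset.card_filter, sum_two, Finset.mul_sum]
  simp only [dup_fin, two_mul]

theorem dot_dup {t : ℕ} (a : Fin (2 * t) → ZMod 2) (y : Fin t → ZMod 2) :
    dot a (dup y) =
      dot (fun j => a (finProdFinEquiv (0, j)) + a (finProdFinEquiv (1, j))) y := by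
  unfold dot
  rw [sum_two]
  simp only [dup_fin, add_mul]

theorem dup_inj {t : ℕ} : Function.Injective (dup (t := t)) := by
  intro y z h
  funext j
  rw [← dup_fin y 0 j, h, dup_fin]

theorem stmt_14 (t : ℕ) (ht : 0 < t)
    (f : (Fin (2 * t) → ZMod 2) → ZMod 2) (k : ℕ) :
    NL (fun y : Fin t → ZMod 2 => f (dup y)) (E t k)
      ≤ NL f (E (2 * t) (2 * k)) := by
  unfold NL
  refine le_csInf ⟨_, 0, 0, rfl⟩ ?_
  rintro m ⟨a, ε, rfl⟩
  refine le_trans (Nat.sInf_le ⟨fun j => a (finProdFinEquiv (0, j)) + a (finProdFinEquiv (1, j)), ε, rfl⟩)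
    (Finset.card_le_card_of_injOn (s := (E t k).filter (fun y => f (dup y) ≠
      dot (fun j => a (finProdFinEquiv (0, j)) + a (finProdFinEquiv (1, j))) y + ε))
      dup ?_ dup_inj.injOn)
  intro y hy
  simp only [E, Finset.coe_filter, Finset.mem_filter, Finset.mem_univ, true_and,
    Set.mem_ofPred_eq] at hy ⊢
  rw [norm_dup, dot_dup, hy.1]
  exact ⟨rfl, hy.2⟩
end

section
/- Let n = 2^l with l ≥ 3, and let f : F_2^n → F_2 satisfy f(0) = 0, f(1) = 1, and f(ρ(x)) = f(x) ⊕ 1 for all x ∈ F_2^n \ {0, 1}. Then NL_{E_{n,2}}(f) ≥ 5. -/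
def vv (n i j : ℕ) : Fin n → ZMod 2 := fun k => if k.val = i ∨ k.val = j then 1 else 0

lemma vv_norm {n i j : ℕ} (hij : i < j) (hj : j < n) : hammingNorm (vv n i j) = 2 := by
  unfold hammingNorm
  have : (Finset.univ.filter (fun k : Fin n => vv n i j k ≠ 0))
      = {⟨i, by omega⟩, ⟨j, hj⟩} := by
    ext k
    simp [vv, Fin.ext_iff] <;> try tauto
  rw [this, Finset.card_pair]
  simp [Fin.ext_iff]; omega

lemma vv_dot {n i j : ℕ} (a : Fin n → ZMod 2) (hij : i < j) (hj : j < n) :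
    dot a (vv n i j) = a ⟨i, by omega⟩ + a ⟨j, hj⟩ := by
  have h : ∀ k : Fin n, a k * vv n i j k = if k ∈ ({⟨i, by omega⟩, ⟨j, hj⟩} : Finset (Fin n)) then a k else 0 := by
    intro k
    simp [vv, Fin.ext_iff] <;> try tauto
  unfold dot
  simp_rw [h]
  rw [Finset.sum_ite_mem, Finset.univ_inter, Finset.sum_pair]
  simp [Fin.ext_iff]; omega

lemma vv_rho {n i j : ℕ} (hi : i + 1 < n) (hj : j + 1 < n) :
    rho (vv n (i+1) (j+1)) = vv n i j := by
  funext k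
  have hk := k.2
  have : ∀ m, m + 1 < n → (((k.val + 1) % n = m + 1) ↔ k.val = m) := by
    intro m hm
    rcases Nat.lt_or_ge (k.val + 1) n with h | h
    · rw [Nat.mod_eq_of_lt h]; omega
    · have : k.val + 1 = n := by omega
      rw [this, Nat.mod_self]; omega
  simp [rho, vv, this i hi, this j hj]

lemma vv_inj {n i j i' j' : ℕ} (hij : i < j) (hj : j < n) (hij' : i' < j') (hj' : j' < n)
    (h : vv n i j = vv n i' j') : i = i' ∧ j = j' := by
  have h1 := congrFun h ⟨i, by omega⟩
  have h2 := congrFun h ⟨j, by omega⟩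
  simp [vv] at h1 h2
  omega

lemma zz (a b c d : ZMod 2) (h : a + b + c + d = 1) : a ≠ 0 ∨ b ≠ 0 ∨ c ≠ 0 ∨ d ≠ 0 := by
  revert a b c d; decide

def col (i j : ℕ) : ℕ :=
  match i, j with
  | 0, 6 => 0 | 1, 7 => 0 | 0, 1 => 0 | 6, 7 => 0
  | 0, 4 => 1 | 3, 7 => 1 | 0, 3 => 1 | 4, 7 => 1
  | 2, 6 => 2 | 1, 5 => 2 | 1, 2 => 2 | 5, 6 => 2
  | 0, 2 => 3 | 5, 7 => 3 | 0, 5 => 3 | 2, 7 => 3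
  | 2, 4 => 4 | 3, 5 => 4 | 2, 3 => 4 | 4, 5 => 4
  | _, _ => 5

theorem stmt_17 (l : ℕ) (hl : 3 ≤ l) (n : ℕ) (hn : n = 2 ^ l)
    (f : (Fin n → ZMod 2) → ZMod 2)
    (hf0 : f 0 = 0) (hf1 : f 1 = 1)
    (hf : ∀ x : Fin n → ZMod 2, x ≠ 0 → x ≠ 1 → f (rho x) = f x + 1) :
    5 ≤ NL f (E n 2) := by
  have h8 : 8 ≤ n := by
    rw [hn]; exact (Nat.pow_le_pow_right (by norm_num) hl : 2 ^ 3 ≤ 2 ^ l)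
  unfold NL
  refine le_csInf (Set.nonempty_of_mem ⟨0, 0, rfl⟩) ?_
  rintro m ⟨a, ε, rfl⟩
  have hstep : ∀ i j, i < j → j + 1 < n → f (vv n (i+1) (j+1)) = f (vv n i j) + 1 := by
    intro i j hij hj
    have hnorm := vv_norm (n := n) (i := i+1) (j := j+1) (by omega) hj
    have := hf (vv n (i+1) (j+1)) ?_ ?_
    · rw [vv_rho (by omega) hj] at this
      rw [this, add_assoc]
      have : (1 + 1 : ZMod 2) = 0 := by decide
      rw [this, add_zero]
    · intro h; rw [h] at hnorm; simp at hnorm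
    · intro h; rw [h] at hnorm; simp [hammingNorm] at hnorm; omega
  have hshift : ∀ s i d, 0 < d → i + d + s < n →
      f (vv n (i+s) (i+d+s)) = f (vv n i (i+d)) + s := by
    intro s
    induction s with
    | zero => intro i d _ _; simp
    | succ s ih =>
      intro i d hd h
      rw [← add_assoc, ← add_assoc, hstep _ _ (by omega) (by omega), ih i d hd (by omega)]
      push_cast; ring
  let A : ℕ → ZMod 2 := fun i => if h : i < n then a ⟨i, h⟩ else 0
  let H : ℕ → ℕ → ZMod 2 := fun i j => f (vv n i j) + (A i + A j + ε)
  have hbad : ∀ i j, i < j → j < 8 → H i j ≠ 0 →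
      vv n i j ∈ (E n 2).filter (fun x => f x ≠ dot a x + ε) := by
    intro i j hij hj hH
    have hi' : i < n := by omega
    have hj' : j < n := by omega
    rw [Finset.mem_filter]
    refine ⟨by simp [E, vv_norm hij hj'], ?_⟩
    rw [vv_dot a hij hj']
    intro h
    apply hH
    simp only [H, A, hi', hj', dif_pos, h]
    exact CharTwo.add_self_eq_zero _
  have key : ∀ i k e, i < k → 0 < e → (k + e < 8) → i + e ≠ k → 
      ((k - i + e : ℕ) : ZMod 2) = 1 → 
      H i k + H (i+e) (k+e) + H i (i+e) + H k (k+e) = 1 := by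
    intro i k e hik he hk _ hp
    obtain ⟨d, rfl⟩ := Nat.exists_eq_add_of_lt hik
    have h1 := hshift e i (d+1) (by omega) (by omega)
    have h2 := hshift (d+1) i e (by omega) (by omega)
    have e1 : i + e + (d+1) = i + d + 1 + e := by ring
    have e2 : i + (d + 1) + e = i + d + 1 + e := by ring
    have e3 : i + (d + 1) = i + d + 1 := by ring
    rw [e1, e3] at h2
    rw [e2, e3] at h1
    have e4 : i + d + 1 - i + e = d + 1 + e := by omega
    rw [e4] at hp
    push_cast at hp h1 h2
    simp only [H, h1, h2]
    have two : (2 : ZMod 2) = 0 := by decide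
    linear_combination hp + (f (vv n i (i+d+1)) + f (vv n i (i+e)) + A i + A (i+d+1) + A (i+e) + A (i+d+1+e) + 2*ε) * two
  have main : ∀ t : Fin 5, ∃ i j, i < j ∧ j < 8 ∧ col i j = t.val ∧ H i j ≠ 0 := by
    have mk : ∀ t i k e, i < k → 0 < e → k + e < 8 → i + e ≠ k → 
      ((k - i + e : ℕ) : ZMod 2) = 1 → col i k = t → col (i+e) (k+e) = t → col i (i+e) = t →
      col k (k+e) = t → ∃ i j, i < j ∧ j < 8 ∧ col i j = t ∧ H i j ≠ 0 := by
      intro t i k e h1 h2 h3 h4 h5 c1 c2 c3 c4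
      rcases zz _ _ _ _ (key i k e h1 h2 h3 h4 h5) with h | h | h | h
      · exact ⟨_, _, by omega, by omega, c1, h⟩
      · exact ⟨_, _, by omega, by omega, c2, h⟩
      · exact ⟨_, _, by omega, by omega, c3, h⟩
      · exact ⟨_, _, by omega, by omega, c4, h⟩
    intro t
    fin_cases t
    · exact mk 0 0 1 6 (by decide) (by decide) (by decide) (by decide) (by decide) rfl rfl rfl rfl
    · exact mk 1 0 3 4 (by decide) (by decide) (by decide) (by decide) (by decide) rfl rfl rfl rfl
    · exact mk 2 1 2 4 (by decide) (by decide) (by decide) (by decide) (by decide) rfl rfl rfl rfl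
    · exact mk 3 0 5 2 (by decide) (by decide) (by decide) (by decide) (by decide) rfl rfl rfl rfl
    · exact mk 4 2 3 2 (by decide) (by decide) (by decide) (by decide) (by decide) rfl rfl rfl rfl
  choose I J hIJ hJ hc hH using main
  have := Finset.card_le_card_of_injOn (s := (Finset.univ : Finset (Fin 5)))
    (t := (E n 2).filter (fun x => f x ≠ dot a x + ε)) (fun t => vv n (I t) (J t))
    (fun t _ => hbad _ _ (hIJ t) (hJ t) (hH t)) (by
      intro s _ t _ hst
      have := hJ s
      have := hJ t
      obtain ⟨h1, h2⟩ := vv_inj (hIJ s) (by omega) (hIJ t) (by omega) hst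
      apply Fin.ext
      rw [← hc s, ← hc t, h1, h2])
  simpa using this
end

section
/- Let n = 2^l with l ≥ 3, and let f : F_2^n → F_2 satisfy f(0) = 0, f(1) = 1, and f(ρ(x)) = f(x) ⊕ 1 for all x ∈ F_2^n \ {0, 1}. Then for every integer i with 2 ≤ i ≤ l−2 one has NL_{E_{n,2^i}}(f) ≥ 5, and NL_{E_{n,2^{l−1}}}(f) ≥ 19. In particular, the 2^i-weight nonlinearity of f is nonzero for every i with 2 ≤ i ≤ l−1. -/
theorem rho_eq {n : ℕ} [NeZero n] (x : Fin n → ZMod 2) :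
    rho x = x ∘ (Equiv.addRight (1 : Fin n)) := by
  funext i
  simp only [rho, Function.comp, Equiv.coe_addRight]
  congr 1
  apply Fin.ext
  simp [Fin.val_add]

theorem rho_inj {n : ℕ} [NeZero n] : Function.Injective (rho (n := n)) := by
  intro x y h
  rw [rho_eq, rho_eq] at h
  exact (Equiv.addRight (1 : Fin n)).surjective.injective_comp_right h

theorem norm_rho {n : ℕ} [NeZero n] (x : Fin n → ZMod 2) :
    hammingNorm (rho x) = hammingNorm x := by
  rw [rho_eq]
  unfold hammingNorm
  refine Finset.card_bij (fun i _ => (Equiv.addRight (1 : Fin n)) i) ?_ ?_ ?_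
  · intro i hi
    have hi := (Finset.mem_filter.1 hi).2
    exact Finset.mem_filter.2 ⟨Finset.mem_univ _, hi⟩
  · intro i _ j _ h; exact (Equiv.addRight (1 : Fin n)).injective h
  · intro i hi
    obtain ⟨j, rfl⟩ := (Equiv.addRight (1 : Fin n)).surjective i
    exact ⟨j, Finset.mem_filter.2 ⟨Finset.mem_univ _, (Finset.mem_filter.1 hi).2⟩, rfl⟩

theorem ne_zero_of_mem {n k : ℕ} (hk : 0 < k) {x : Fin n → ZMod 2} (hx : x ∈ E n k) : x ≠ 0 := by
  rintro rfl
  simp [E] at hx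
  omega

theorem ne_one_of_mem {n k : ℕ} (hk : k < n) {x : Fin n → ZMod 2} (hx : x ∈ E n k) : x ≠ 1 := by
  rintro rfl
  simp [E, hammingNorm] at hx
  omega

theorem dot_rho {n : ℕ} [NeZero n] (a x : Fin n → ZMod 2) :
    dot a (rho x) = dot (a ∘ (Equiv.addRight (1 : Fin n)).symm) x := by
  rw [rho_eq]
  unfold dot
  rw [← Equiv.sum_comp (Equiv.addRight (1 : Fin n))
    (fun i => (a ∘ (Equiv.addRight (1 : Fin n)).symm) i * x i)]
  refine Finset.sum_congr rfl fun i _ => ?_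
  simp only [Function.comp, Equiv.symm_apply_apply]

theorem dot_add_left {n : ℕ} (a b x : Fin n → ZMod 2) : dot (a + b) x = dot a x + dot b x := by
  simp [dot, add_mul, Finset.sum_add_distrib]

theorem pairing {n : ℕ} (hn : Even n) (b : Fin n → ZMod 2) (hb : ∑ i, b i = 0) :
    ∃ (p q : ℕ) (e : Fin n ≃ (Fin p ⊕ Fin q) × Bool), 2 * (p + q) = n ∧
      ∀ t c d, b (e.symm (t, c)) = b (e.symm (t, d)) := by
  have hz : ∀ z : ZMod 2, z = if z = 1 then 1 else 0 := by decide
  have h1 : Even (Fintype.card {i // b i = 1}) := by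
    rw [Fintype.card_subtype]
    have : ((Finset.univ.filter (fun i => b i = 1)).card : ZMod 2) = 0 := by
      rw [← hb, Finset.card_filter]
      push_cast
      refine Finset.sum_congr rfl fun i _ => ?_
      exact (hz (b i)).symm
    exact (ZMod.natCast_eq_zero_iff_even).1 this
  have h2 : Fintype.card {i // b i = 1} + Fintype.card {i // ¬ b i = 1} = n := by
    rw [Fintype.card_subtype_compl]
    have := Fintype.card_subtype_le (fun i => b i = 1)
    simp at this ⊢
    omega
  have h3 : Even (Fintype.card {i // ¬ b i = 1}) := by
    rw [← h2] at hn
    exact (Nat.even_add.1 hn).1 h1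
  obtain ⟨p, hp⟩ := h1
  obtain ⟨q, hq⟩ := h3
  have e1 : {i // b i = 1} ≃ Fin p × Bool := Fintype.equivOfCardEq (by simp [hp]; omega)
  have e2 : {i // ¬ b i = 1} ≃ Fin q × Bool := Fintype.equivOfCardEq (by simp [hq]; omega)
  refine ⟨p, q, (Equiv.sumCompl (fun i => b i = 1)).symm.trans
    ((Equiv.sumCongr e1 e2).trans (Equiv.sumProdDistrib _ _ _).symm), by omega, ?_⟩
  have hz' : ∀ z w : ZMod 2, z ≠ 1 → w ≠ 1 → z = w := by decide
  rintro (t | t) c d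
  · simp
    rw [(e1.symm (t, c)).2, (e1.symm (t, d)).2]
  · simp
    exact hz' _ _ (e2.symm (t, c)).2 (e2.symm (t, d)).2

theorem card_T {n k : ℕ} (hn : Even n) (b : Fin n → ZMod 2) (hb : ∑ i, b i = 0) :
    (n / 2).choose k ≤ ((E n (2 * k)).filter (fun x => dot b x = 0)).card := by
  obtain ⟨p, q, e, hpq, he⟩ := pairing hn b hb
  have : (n / 2).choose k = (Finset.powersetCard k (Finset.univ : Finset (Fin p ⊕ Fin q))).card := by
    rw [Finset.card_powersetCard]
    simp
    congr 1; omega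
  rw [this]
  refine Finset.card_le_card_of_injOn
    (fun S i => if (e i).1 ∈ S then 1 else 0) ?_ ?_
  · intro S hS
    simp only [Finset.mem_coe, Finset.mem_powersetCard] at hS
    simp only [Finset.coe_filter, Set.mem_ofPred_eq, E, Finset.mem_filter, Finset.mem_univ, true_and]
    constructor
    · unfold hammingNorm
      rw [Finset.card_filter, ← Equiv.sum_comp e.symm, Fintype.sum_prod_type]
      simp
      rw [hS.2]; ring
    · unfold dot
      rw [← Equiv.sum_comp e.symm, Fintype.sum_prod_type]
      refine Finset.sum_eq_zero fun t _ => ?_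
      have := he t true false
      simp [this]
      intro _
      exact CharTwo.add_self_eq_zero _
  · intro S _ S' _ h
    ext t
    have := congrFun h (e.symm (t, true))
    by_cases h1 : t ∈ S <;> by_cases h2 : t ∈ S' <;> simp_all

theorem main_bound {n k : ℕ} [NeZero n] (hn : Even n) (hk : 0 < k) (hkn : 2 * k < n)
    (f : (Fin n → ZMod 2) → ZMod 2)
    (hf : ∀ x : Fin n → ZMod 2, x ≠ 0 → x ≠ 1 → f (rho x) = f x + 1)
    (a : Fin n → ZMod 2) (ε : ZMod 2) :
    (n / 2).choose k ≤ 2 * ((E n (2 * k)).filter (fun x => f x ≠ dot a x + ε)).card := by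
  set D := (E n (2 * k)).filter (fun x => f x ≠ dot a x + ε) with hD
  set b := a + a ∘ (Equiv.addRight (1 : Fin n)).symm with hbdef
  have hb : ∑ i, b i = 0 := by
    simp only [hbdef, Pi.add_apply, Finset.sum_add_distrib]
    have : ∑ i, (a ∘ (Equiv.addRight (1 : Fin n)).symm) i = ∑ i, a i :=
      Equiv.sum_comp (Equiv.addRight (1 : Fin n)).symm a
    rw [this]
    exact CharTwo.add_self_eq_zero _
  refine (card_T hn b hb).trans ?_
  set T := (E n (2 * k)).filter (fun x => dot b x = 0) with hT
  have h1 : (T.filter (fun x => x ∈ D)).card ≤ D.card :=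
    Finset.card_le_card (fun x hx => (Finset.mem_filter.1 hx).2)
  have h2 : (T.filter (fun x => ¬ x ∈ D)).card ≤ D.card := by
    refine Finset.card_le_card_of_injOn rho ?_ rho_inj.injOn
    intro x hx
    have hx := Finset.mem_coe.1 hx
    rw [Finset.mem_filter] at hx
    obtain ⟨hxT, hxD⟩ := hx
    rw [hT, Finset.mem_filter] at hxT
    obtain ⟨hxE, hxb⟩ := hxT
    have hff := hf x (ne_zero_of_mem (by omega) hxE) (ne_one_of_mem hkn hxE)
    rw [hbdef, dot_add_left, ← dot_rho] at hxb
    rw [Finset.mem_coe, hD, Finset.mem_filter]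
    have hfx : f x = dot a x + ε := by
      by_contra hc
      exact hxD (by rw [hD, Finset.mem_filter]; exact ⟨hxE, hc⟩)
    constructor
    · simpa [E, norm_rho] using hxE
    · rw [hff, hfx]
      have hz : ∀ u w ε : ZMod 2, u + w = 0 → u + ε + 1 ≠ w + ε := by decide
      exact hz _ _ _ hxb
  have := Finset.card_filter_add_card_filter_not (s := T) (fun x => x ∈ D)
  omega

theorem le_NL {n m : ℕ} (f : (Fin n → ZMod 2) → ZMod 2) (S : Finset (Fin n → ZMod 2))
    (h : ∀ a ε, m ≤ (S.filter (fun x => f x ≠ dot a x + ε)).card) : m ≤ NL f S := by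
  unfold NL
  apply le_csInf
  · exact ⟨_, 0, 0, rfl⟩
  · rintro _ ⟨a, ε, rfl⟩
    exact h a ε

def cN (r : ℕ) : ℕ := if r = 8 then 4 else if r = 9 then 2 else 8
def cX (r : ℕ) : ℕ := [15, 23, 27, 29, 39, 43, 45, 53, 51, 85].getD r 0
def cC (r j : ℕ) : ℕ := (cX r / 2 ^ j + cX r * 2 ^ (8 - j)) % 256
def vec (X : ℕ) : Fin 8 → ZMod 2 := fun i => ((X / 2 ^ i.val : ℕ) : ZMod 2)
def par (A0 A1 A2 A3 A4 A5 A6 A7 X : ℕ) : ℕ :=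
  A0 * X + A1 * (X / 2) + A2 * (X / 4) + A3 * (X / 8) + A4 * (X / 16) + A5 * (X / 32)
    + A6 * (X / 64) + A7 * (X / 128)
def cnt (A0 A1 A2 A3 A4 A5 A6 A7 r t : ℕ) : ℕ :=
  ∑ j ∈ Finset.range (cN r), (par A0 A1 A2 A3 A4 A5 A6 A7 (cC r j) + j + t) % 2

set_option synthInstance.maxSize 2000 in
set_option synthInstance.maxHeartbeats 400000 in
theorem big_check : ∀ A0 < 2, ∀ A1 < 2, ∀ A2 < 2, ∀ A3 < 2, ∀ A4 < 2, ∀ A5 < 2, ∀ A6 < 2, ∀ A7 < 2,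
    19 ≤ ∑ r ∈ Finset.range 10, min (cnt A0 A1 A2 A3 A4 A5 A6 A7 r 0)
      (cnt A0 A1 A2 A3 A4 A5 A6 A7 r 1) := by
  decide +kernel

theorem vec_rho : ∀ r < 10, ∀ j < cN r, rho (vec (cC r j)) = vec (cC r (j + 1)) := by
  decide +kernel

theorem vec_mem : ∀ r < 10, ∀ j < cN r, hammingNorm (vec (cC r j)) = 4 := by
  decide +kernel

theorem code_dec : ∀ r < 10, ∀ j < cN r, ∑ i, (vec (cC r j) i).val * 2 ^ i.val = cC r j := by
  decide +kernel

set_option synthInstance.maxSize 2000 in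
set_option synthInstance.maxHeartbeats 400000 in
theorem code_inj : ∀ r < 10, ∀ j < cN r, ∀ r' < 10, ∀ j' < cN r', cC r j = cC r' j' →
    r = r' ∧ j = j' := by
  decide +kernel

theorem bound8 (f : (Fin 8 → ZMod 2) → ZMod 2)
    (hf : ∀ x : Fin 8 → ZMod 2, x ≠ 0 → x ≠ 1 → f (rho x) = f x + 1)
    (a : Fin 8 → ZMod 2) (ε : ZMod 2) :
    19 ≤ ((E 8 4).filter (fun x => f x ≠ dot a x + ε)).card := by
  set D := (E 8 4).filter (fun x => f x ≠ dot a x + ε) with hD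
  have hE : ∀ r < 10, ∀ j < cN r, vec (cC r j) ∈ E 8 4 := by
    intro r hr j hj
    simp [E, vec_mem r hr j hj]
  have hfj : ∀ r < 10, ∀ j < cN r, f (vec (cC r j)) = f (vec (cC r 0)) + (j : ZMod 2) := by
    intro r hr j
    induction j with
    | zero => simp
    | succ j ih =>
      intro hj
      have hj' : j < cN r := by omega
      have hm := hE r hr j hj'
      rw [← vec_rho r hr j hj', hf _ (ne_zero_of_mem (by norm_num) hm)
        (ne_one_of_mem (by norm_num) hm), ih hj']
      push_cast; ring
  have hdot : ∀ X, dot a (vec X) = ((par (a 0).val (a 1).val (a 2).val (a 3).val (a 4).val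
      (a 5).val (a 6).val (a 7).val X : ℕ) : ZMod 2) := by
    intro X
    simp only [dot, vec, Fin.sum_univ_eight, par]
    push_cast
    simp
  have hsum : ∑ r ∈ Finset.range 10, ∑ j ∈ Finset.range (cN r),
      (if f (vec (cC r j)) ≠ dot a (vec (cC r j)) + ε then 1 else 0) ≤ D.card := by
    rw [Finset.sum_sigma', ← Finset.card_filter]
    refine Finset.card_le_card_of_injOn (fun p => vec (cC p.1 p.2)) ?_ ?_
    · rintro ⟨r, j⟩ hp
      simp at hp
      simp only [hD, Finset.coe_filter, Set.mem_ofPred_eq]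
      exact ⟨hE r hp.1.1 j hp.1.2, hp.2⟩
    · rintro ⟨r, j⟩ hp ⟨r', j'⟩ hp' h
      simp at hp hp'
      simp only at h
      have h1 := code_dec r hp.1.1 j hp.1.2
      have h2 := code_dec r' hp'.1.1 j' hp'.1.2
      rw [h, h2] at h1
      obtain ⟨rfl, rfl⟩ := code_inj r hp.1.1 j hp.1.2 r' hp'.1.1 j' hp'.1.2 h1.symm
      rfl
  refine le_trans ?_ hsum
  refine (big_check _ (ZMod.val_lt (a 0)) _ (ZMod.val_lt (a 1)) _ (ZMod.val_lt (a 2))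
    _ (ZMod.val_lt (a 3)) _ (ZMod.val_lt (a 4)) _ (ZMod.val_lt (a 5)) _ (ZMod.val_lt (a 6))
    _ (ZMod.val_lt (a 7))).trans ?_
  refine Finset.sum_le_sum fun r hr => ?_
  have hr := Finset.mem_range.1 hr
  have key : ∀ t : ℕ, (t : ZMod 2) = f (vec (cC r 0)) + ε →
      cnt (a 0).val (a 1).val (a 2).val (a 3).val (a 4).val
      (a 5).val (a 6).val (a 7).val r t = ∑ j ∈ Finset.range (cN r),
      (if f (vec (cC r j)) ≠ dot a (vec (cC r j)) + ε then 1 else 0) := by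
    intro t ht
    refine Finset.sum_congr rfl fun j hj => ?_
    have hj := Finset.mem_range.1 hj
    rw [hfj r hr j hj, hdot]
    generalize par _ _ _ _ _ _ _ _ _ = P
    have h0 : (f (vec (cC r 0)) + (j : ZMod 2) = (P : ZMod 2) + ε) ↔ (P + j + t) % 2 = 0 := by
      rw [← Nat.dvd_iff_mod_eq_zero, ← ZMod.natCast_eq_zero_iff]
      push_cast
      rw [ht]
      generalize f (vec (cC r 0)) = u
      generalize (P : ZMod 2) = P
      generalize (j : ZMod 2) = j
      clear * -
      revert u P j ε
      decide
    by_cases h : (P + j + t) % 2 = 0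
    · rw [if_neg (not_not.2 (h0.2 h)), h]
    · rw [if_pos (fun h' => h (h0.1 h'))]; omega
  have h01 : ∀ z : ZMod 2, ((0 : ℕ) : ZMod 2) = z ∨ ((1 : ℕ) : ZMod 2) = z := by decide
  rcases h01 (f (vec (cC r 0)) + ε) with h | h
  · rw [← key 0 h]; exact min_le_left _ _
  · rw [← key 1 h]; exact min_le_right _ _

theorem choose_ge {m j : ℕ} (h2 : 2 ≤ j) (hj : 2 * j ≤ m) (hm : 8 ≤ m) : 28 ≤ m.choose j := by
  calc 28 = Nat.choose 8 2 := by decide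
    _ ≤ m.choose 2 := Nat.choose_le_choose 2 hm
    _ ≤ m.choose j := by
      obtain ⟨j, rfl⟩ := Nat.exists_eq_add_of_le h2
      clear h2
      induction j with
      | zero => exact le_rfl
      | succ j ih =>
        exact (ih (by omega)).trans (Nat.choose_le_succ_of_lt_half_left (by omega))

theorem stmt_18 (l : ℕ) (hl : 3 ≤ l) (n : ℕ) (hn : n = 2 ^ l)
    (f : (Fin n → ZMod 2) → ZMod 2)
    (hf0 : f 0 = 0) (hf1 : f 1 = 1)
    (hf : ∀ x : Fin n → ZMod 2, x ≠ 0 → x ≠ 1 → f (rho x) = f x + 1) :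
    (∀ i : ℕ, 2 ≤ i → i ≤ l - 2 → 5 ≤ NL f (E n (2 ^ i))) ∧
    19 ≤ NL f (E n (2 ^ (l - 1))) ∧
    (∀ i : ℕ, 2 ≤ i → i ≤ l - 1 → NL f (E n (2 ^ i)) ≠ 0) := by
  have hpos : 0 < n := by rw [hn]; positivity
  have : NeZero n := ⟨by omega⟩
  have A : ∀ i : ℕ, 2 ≤ i → i ≤ l - 2 → 5 ≤ NL f (E n (2 ^ i)) := by
    intro i hi hil
    apply le_NL
    intro a ε
    obtain ⟨i, rfl⟩ := Nat.exists_eq_add_of_le hi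
    obtain ⟨d, rfl⟩ : ∃ d, l = (i + d) + 4 := ⟨l - i - 4, by omega⟩
    have e1 : 2 ^ (2 + i) = 2 * (2 * 2 ^ i) := by ring
    have e2 : n = 16 * (2 ^ i * 2 ^ d) := by rw [hn]; ring
    have p1 : 0 < 2 ^ i := by positivity
    have p2 : 0 < 2 ^ d := by positivity
    have p3 : 2 ^ i ≤ 2 ^ i * 2 ^ d := Nat.le_mul_of_pos_right _ p2
    rw [e1]
    have hb := main_bound (n := n) (k := 2 * 2 ^ i) ⟨8 * (2 ^ i * 2 ^ d), by omega⟩ (by omega)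
      (by omega) f hf a ε
    have := choose_ge (m := n / 2) (j := 2 * 2 ^ i) (by omega) (by omega) (by omega)
    omega
  have B : 19 ≤ NL f (E n (2 ^ (l - 1))) := by
    apply le_NL
    intro a ε
    rcases Nat.lt_or_ge 3 l with h | h
    · obtain ⟨d, rfl⟩ : ∃ d, l = d + 4 := ⟨l - 4, by omega⟩
      have e1 : 2 ^ (d + 4 - 1) = 2 * (4 * 2 ^ d) := by
        rw [show d + 4 - 1 = d + 3 by omega]; ring
      have e2 : n = 16 * 2 ^ d := by rw [hn]; ring
      have p2 : 0 < 2 ^ d := by positivity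
      rw [e1]
      have hb := main_bound (n := n) (k := 4 * 2 ^ d) ⟨8 * 2 ^ d, by omega⟩ (by omega)
        (by omega) f hf a ε
      have h70 : 70 ≤ (n / 2).choose (4 * 2 ^ d) := by
        have : n / 2 = 2 * (4 * 2 ^ d) := by omega
        rw [this, ← Nat.centralBinom_eq_two_mul_choose]
        calc 70 = Nat.choose 8 4 := by decide
          _ ≤ (2 * (4 * 2 ^ d)).choose 4 := Nat.choose_le_choose 4 (by omega)
          _ ≤ _ := Nat.choose_le_centralBinom _ _
      omega
    · obtain rfl : l = 3 := by omega
      obtain rfl : n = 8 := by simpa using hn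
      exact bound8 f hf a ε
  refine ⟨A, B, ?_⟩
  intro i hi hil
  rcases Nat.lt_or_ge (l - 2) i with h | h
  · obtain rfl : i = l - 1 := by omega
    omega
  · have := A i hi h
    omega
end

section
/- Let n = 2^l with l ≥ 4, let i be an integer with 2 ≤ i ≤ n/4 + 1, and define R = { (1, y_1, 0^{n/4}, y_2) ∈ F_2^n : y_1 ∈ F_2^{n/4−1} with w_H(y_1) = i−2, y_2 ∈ F_2^{n/2} with w_H(y_2) = i }, where elements are concatenations of a leading coordinate 1, the block y_1, a block of n/4 zeros, and the block y_2. Then no two elements of R lie in the same cyclic-shift orbit: for all x_1, x_2 ∈ R and every j with 1 ≤ j ≤ n−1, x_1 ≠ ρ^j(x_2). -/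
/-- Membership in the set `R` of vectors of the form `(1, y₁, 0^{n/4}, y₂)` with
`y₁ ∈ F_2^{n/4-1}` of Hamming weight `i-2` (coordinates `1 ≤ p < n/4`),
a zero block on coordinates `n/4 ≤ p < n/2`, and `y₂ ∈ F_2^{n/2}` of Hamming
weight `i` (coordinates `n/2 ≤ p < n`), where `n = 2^l`. -/
def inR (l i : ℕ) (x : Fin (2 ^ l) → ZMod 2) : Prop :=
  x ⟨0, Nat.two_pow_pos l⟩ = 1 ∧
  (∀ p : Fin (2 ^ l), 2 ^ l / 4 ≤ p.val → p.val < 2 ^ l / 2 → x p = 0) ∧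
  (Finset.univ.filter
    (fun p : Fin (2 ^ l) => 1 ≤ p.val ∧ p.val < 2 ^ l / 4 ∧ x p = 1)).card = i - 2 ∧
  (Finset.univ.filter
    (fun p : Fin (2 ^ l) => 2 ^ l / 2 ≤ p.val ∧ x p = 1)).card = i

theorem rho_iter {n : ℕ} (x : Fin n → ZMod 2) (j : ℕ) (p : Fin n) :
    (rho^[j] x) p = x ⟨(p.val + j) % n, Nat.mod_lt _ p.pos⟩ := by
  induction j generalizing p with
  | zero => simp [Nat.mod_eq_of_lt p.isLt]
  | succ k ih =>
    rw [Function.iterate_succ_apply']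
    unfold rho
    have := ih ⟨(p.val + 1) % n, Nat.mod_lt _ p.pos⟩
    unfold rho at this
    rw [this]
    congr 2
    simp only [Nat.mod_add_mod]
    congr 1
    omega

theorem small_shift (l i q : ℕ) (hq : 2 ^ l = 4 * q)
    (x y : Fin (2 ^ l) → ZMod 2) (hx : inR l i x) (hy : inR l i y)
    (j : ℕ) (hj1 : 1 ≤ j) (hj2 : j < q)
    (h : ∀ p : Fin (2 ^ l), x p = y ⟨(p.val + j) % 2 ^ l, Nat.mod_lt _ p.pos⟩) : False := by
  obtain ⟨hx0, hxz, hxc, -⟩ := hx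
  obtain ⟨-, hyz, hyc, -⟩ := hy
  have key : (insert (⟨0, Nat.two_pow_pos l⟩ : Fin (2 ^ l)) (Finset.univ.filter
      (fun p : Fin (2 ^ l) => 1 ≤ p.val ∧ p.val < 2 ^ l / 4 ∧ x p = 1))).card ≤
      (Finset.univ.filter
      (fun p : Fin (2 ^ l) => 1 ≤ p.val ∧ p.val < 2 ^ l / 4 ∧ y p = 1)).card := by
    have hlt : ∀ p ∈ (insert (⟨0, Nat.two_pow_pos l⟩ : Fin (2 ^ l)) (Finset.univ.filter
      (fun p : Fin (2 ^ l) => 1 ≤ p.val ∧ p.val < 2 ^ l / 4 ∧ x p = 1))),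
        p.val < q ∧ x p = 1 := by
      intro p hp
      simp only [Finset.mem_insert, Finset.mem_filter, Finset.mem_univ, true_and] at hp
      rcases hp with rfl | hp
      · exact ⟨by simp; omega, hx0⟩
      · exact ⟨by omega, hp.2.2⟩
    apply Finset.card_le_card_of_injOn
      (fun p => (⟨(p.val + j) % 2 ^ l, Nat.mod_lt _ p.pos⟩ : Fin (2 ^ l)))
    · intro p hp
      obtain ⟨h1, h2⟩ := hlt p hp
      have hm : (p.val + j) % 2 ^ l = p.val + j := Nat.mod_eq_of_lt (by omega)
      rw [h p] at h2
      have : p.val + j < q := by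
        by_contra hc
        have := hyz ⟨(p.val + j) % 2 ^ l, Nat.mod_lt _ p.pos⟩ (by simp only [hm]; omega)
          (by simp only [hm]; omega)
        rw [this] at h2
        exact absurd h2 (by decide)
      simp only [Finset.coe_filter, Finset.mem_univ, true_and, Set.mem_setOf_eq]
      refine ⟨by rw [hm]; omega, by rw [hm]; omega, h2⟩
    · intro p hp p' hp' he
      have h1 := (hlt p hp).1
      have h2 := (hlt p' hp').1
      have hm : (p.val + j) % 2 ^ l = p.val + j := Nat.mod_eq_of_lt (by omega)
      have hm' : (p'.val + j) % 2 ^ l = p'.val + j := Nat.mod_eq_of_lt (by omega)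
      simp only [Fin.mk.injEq, hm, hm'] at he
      exact Fin.ext (by omega)
  rw [Finset.card_insert_of_notMem (by simp), hxc, hyc] at key
  omega

theorem half_shift (l i q : ℕ) (hq : 2 ^ l = 4 * q) (hi : 2 ≤ i)
    (x y : Fin (2 ^ l) → ZMod 2) (hx : inR l i x) (hy : inR l i y)
    (h : ∀ p : Fin (2 ^ l), x p = y ⟨(p.val + 2 * q) % 2 ^ l, Nat.mod_lt _ p.pos⟩) : False := by
  obtain ⟨-, -, -, hxc⟩ := hx
  obtain ⟨-, hyz, hyc, -⟩ := hy
  have hm : ∀ p : Fin (2 ^ l), 2 ^ l / 2 ≤ p.val → (p.val + 2 * q) % 2 ^ l = p.val - 2 * q := by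
    intro p hp
    have := p.isLt
    rw [Nat.mod_eq_sub_mod (by omega), Nat.mod_eq_of_lt (by omega)]
    omega
  have key : (Finset.univ.filter
      (fun p : Fin (2 ^ l) => 2 ^ l / 2 ≤ p.val ∧ x p = 1)).card ≤
      (insert (⟨0, Nat.two_pow_pos l⟩ : Fin (2 ^ l)) (Finset.univ.filter
      (fun p : Fin (2 ^ l) => 1 ≤ p.val ∧ p.val < 2 ^ l / 4 ∧ y p = 1))).card := by
    apply Finset.card_le_card_of_injOn
      (fun p => (⟨(p.val + 2 * q) % 2 ^ l, Nat.mod_lt _ p.pos⟩ : Fin (2 ^ l)))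
    · intro p hp
      simp only [Finset.coe_filter, Finset.mem_univ, true_and, Set.mem_setOf_eq] at hp
      obtain ⟨h1, h2⟩ := hp
      have hm := hm p h1
      have hp := p.isLt
      rw [h p] at h2
      have : p.val - 2 * q < q := by
        by_contra hc
        have := hyz ⟨(p.val + 2 * q) % 2 ^ l, Nat.mod_lt _ p.pos⟩ (by simp only [hm]; omega)
          (by simp only [hm]; omega)
        rw [this] at h2
        exact absurd h2 (by decide)
      rw [Finset.mem_coe, Finset.mem_insert, Finset.mem_filter]
      by_cases h0 : p.val - 2 * q = 0
      · left
        exact Fin.ext (by simp only [hm]; omega)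
      · right
        exact ⟨Finset.mem_univ _, by simp only [hm]; omega, by simp only [hm]; omega, h2⟩
    · intro p hp p' hp' he
      simp only [Finset.coe_filter, Finset.mem_univ, true_and, Set.mem_setOf_eq] at hp hp'
      simp only [Fin.mk.injEq, hm p hp.1, hm p' hp'.1] at he
      exact Fin.ext (by omega)
  rw [Finset.card_insert_of_notMem (by simp), hxc, hyc] at key
  omega

theorem stmt_19 (l : ℕ) (hl : 4 ≤ l) (i : ℕ)
    (hi2 : 2 ≤ i) (hin : i ≤ 2 ^ l / 4 + 1)
    (x₁ x₂ : Fin (2 ^ l) → ZMod 2) (h₁ : inR l i x₁) (h₂ : inR l i x₂)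
    (j : ℕ) (hj1 : 1 ≤ j) (hj2 : j ≤ 2 ^ l - 1) :
    x₁ ≠ rho^[j] x₂ := by
  intro he
  obtain ⟨q, hq⟩ : ∃ q, 2 ^ l = 4 * q :=
    ⟨2 ^ (l - 2), by rw [show 4 = 2 ^ 2 by norm_num, ← pow_add]; congr 1; omega⟩
  have hA : ∀ p : Fin (2 ^ l), x₁ p = x₂ ⟨(p.val + j) % 2 ^ l, Nat.mod_lt _ p.pos⟩ := by
    intro p; rw [he, rho_iter]
  have hB : ∀ p : Fin (2 ^ l),
      x₂ p = x₁ ⟨(p.val + (2 ^ l - j)) % 2 ^ l, Nat.mod_lt _ p.pos⟩ := by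
    intro p
    rw [hA]
    congr 1
    apply Fin.ext
    simp only [Nat.mod_add_mod]
    rw [show p.val + (2 ^ l - j) + j = p.val + 2 ^ l by omega, Nat.add_mod_right,
      Nat.mod_eq_of_lt p.isLt]
  have c1 : ¬ (q ≤ j ∧ j < 2 * q) := by
    intro hc
    have a := hA ⟨0, Nat.two_pow_pos l⟩
    have hm : (0 + j) % 2 ^ l = j := by rw [zero_add]; exact Nat.mod_eq_of_lt (by omega)
    rw [h₁.1, h₂.2.1 _ (by simp only [hm]; omega) (by simp only [hm]; omega)] at a
    exact absurd a (by decide)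
  have c2 : ¬ (q ≤ 2 ^ l - j ∧ 2 ^ l - j < 2 * q) := by
    intro hc
    have a := hB ⟨0, Nat.two_pow_pos l⟩
    have hm : (0 + (2 ^ l - j)) % 2 ^ l = 2 ^ l - j := by
      rw [zero_add]; exact Nat.mod_eq_of_lt (by omega)
    rw [h₂.1, h₁.2.1 _ (by simp only [hm]; omega) (by simp only [hm]; omega)] at a
    exact absurd a (by decide)
  by_cases hs : j < q
  · exact small_shift l i q hq x₁ x₂ h₁ h₂ j hj1 hs hA
  by_cases hs2 : 2 ^ l - j < q
  · exact small_shift l i q hq x₂ x₁ h₂ h₁ (2 ^ l - j) (by omega) hs2 hB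
  have : j = 2 * q := by omega
  subst this
  exact half_shift l i q hq hi2 x₁ x₂ h₁ h₂ hA
end
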